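/- For every simplicial ring R (a simplicial object in rings), the data W_gr R — with (W_gr R)_n = R_n × R_{n-1} × ... × R_0 equipped with the componentwise ring structure, faces d_0(r_n,...,r_0) = (r_{n-1},...,r_0) and d_i(r_n,...,r_0) = (d_i r_n, ..., d_1 r_{n-i+1}, r_{n-i-1}, ..., r_0) for i > 0, and degeneracies s_i(r_n,...,r_0) = (s_i r_n, ..., s_0 r_{n-i}, r_{n-i}, ..., r_0) — is a simplicial ring, and the unit ι_R : r ↦ (r, d_0 r, ..., d_0^n r) and multiplication μ_R (levelwise the product of first-factor projections) are morphisms of simplicial rings making W_gr a monad on the category of simplicial rings. -/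

import Mathlib

universe u

/-- The data of a simplicial ring: a ring `X n` for each `n`, with face maps
`d n i : X (n+1) → X n` (meaningful for `i ≤ n+1`) and degeneracy maps
`s n i : X n → X (n+1)` (meaningful for `i ≤ n`). -/
structure SRingData where
  X : ℕ → Type u
  ring : ∀ n, Ring (X n)
  d : ∀ n, ℕ → X (n+1) → X n
  s : ∀ n, ℕ → X n → X (n+1)

attribute [instance] SRingData.ring

/-- A simplicial ring: the data satisfies the simplicial identities and all face and
degeneracy maps are ring homomorphisms. -/
structure SRing extends SRingData where
  d_add : ∀ n i (x y : X (n+1)), d n i (x + y) = d n i x + d n i y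
  d_mul : ∀ n i (x y : X (n+1)), d n i (x * y) = d n i x * d n i y
  d_one : ∀ n i, d n i (1 : X (n+1)) = 1
  s_add : ∀ n i (x y : X n), s n i (x + y) = s n i x + s n i y
  s_mul : ∀ n i (x y : X n), s n i (x * y) = s n i x * s n i y
  s_one : ∀ n i, s n i (1 : X n) = 1
  d_d : ∀ n i j, i < j → j ≤ n + 2 → ∀ x : X (n+2),
    d n i (d (n+1) j x) = d n (j-1) (d (n+1) i x)
  s_s : ∀ n i j, i ≤ j → j ≤ n → ∀ x : X n,
    s (n+1) i (s n j x) = s (n+1) (j+1) (s n i x)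
  d_s_lt : ∀ n i j, i < j → j ≤ n + 1 → ∀ x : X (n+1),
    d (n+1) i (s (n+1) j x) = s n (j-1) (d n i x)
  d_s_self : ∀ n j, j ≤ n → ∀ x : X n, d n j (s n j x) = x
  d_s_succ : ∀ n j, j ≤ n → ∀ x : X n, d n (j+1) (s n j x) = x
  d_s_gt : ∀ n i j, j + 1 < i → i ≤ n + 2 → ∀ x : X (n+1),
    d (n+1) i (s (n+1) j x) = s n j (d n (i-1) x)

/-- The underlying family of the W-construction: `WObj R n = R_n × R_{n-1} × ⋯ × R_0`. -/
def WObj (R : SRingData.{u}) : ℕ → Type u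
  | 0 => R.X 0
  | n+1 => R.X (n+1) × WObj R n

/-- Componentwise ring structure on `WObj R n`. -/
instance WRing (R : SRingData.{u}) : ∀ n, Ring (WObj R n)
  | 0 => R.ring 0
  | n+1 => @Prod.instRing _ _ (R.ring (n+1)) (WRing R n)

/-- Face maps of `W_gr R`:
`d_0(r_n,…,r_0) = (r_{n-1},…,r_0)` and
`d_i(r_n,…,r_0) = (d_i r_n, …, d_1 r_{n-i+1}, r_{n-i-1}, …, r_0)` for `i > 0`. -/
def Wd (R : SRingData.{u}) : ∀ n, ℕ → WObj R (n+1) → WObj R n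
  | _, 0, x => x.2
  | 0, i+1, x => R.d 0 (i+1) x.1
  | n+1, i+1, x => (R.d (n+1) (i+1) x.1, Wd R n i x.2)

/-- Degeneracy maps of `W_gr R`:
`s_i(r_n,…,r_0) = (s_i r_n, …, s_0 r_{n-i}, r_{n-i}, r_{n-i-1}, …, r_0)`. -/
def Ws (R : SRingData.{u}) : ∀ n, ℕ → WObj R n → WObj R (n+1)
  | 0, _, x => (R.s 0 0 x, x)
  | n+1, 0, x => (R.s (n+1) 0 x.1, x)
  | n+1, i+1, x => (R.s (n+1) (i+1) x.1, Ws R n i x.2)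

/-- The simplicial-ring data of `W_gr R`. -/
def WgrData (R : SRingData.{u}) : SRingData.{u} where
  X := WObj R
  ring := WRing R
  d := Wd R
  s := Ws R

/-- Levelwise application of a family of maps to the W-construction (`W_gr` on morphisms). -/
def Wmap (R S : SRingData.{u}) (f : ∀ n, R.X n → S.X n) : ∀ n, WObj R n → WObj S n
  | 0, x => f 0 x
  | n+1, x => (f (n+1) x.1, Wmap R S f n x.2)

/-- First-factor projection `(W_gr R)_n = R_n × ⋯ × R_0 → R_n`. -/
def Wfst (R : SRingData.{u}) : ∀ n, WObj R n → R.X n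
  | 0, x => x
  | _+1, x => x.1

/-- The unit `ι_R : R → W_gr R`, `r ↦ (r, d_0 r, d_0² r, …, d_0ⁿ r)`. -/
def Wiota (R : SRingData.{u}) : ∀ n, R.X n → WObj R n
  | 0, r => r
  | n+1, r => (r, Wiota R n (R.d n 0 r))

/-- The multiplication `μ_R : W_gr (W_gr R) → W_gr R`, levelwise the product of the
first-factor projections. -/
def Wmu (R : SRingData.{u}) : ∀ n, WObj (WgrData R) n → WObj R n :=
  Wmap (WgrData R) R (fun n => Wfst R n)

/-- `f` is a morphism of simplicial rings `R → S`: levelwise a ring homomorphism,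
commuting with all face and degeneracy maps. -/
def IsSRingMor (R S : SRingData.{u}) (f : ∀ n, R.X n → S.X n) : Prop :=
  (∀ n (x y : R.X n), f n (x + y) = f n x + f n y) ∧
  (∀ n (x y : R.X n), f n (x * y) = f n x * f n y) ∧
  (∀ n, f n (1 : R.X n) = 1) ∧
  (∀ n i, i ≤ n + 1 → ∀ x : R.X (n+1), f n (R.d n i x) = S.d n i (f (n+1) x)) ∧
  (∀ n i, i ≤ n → ∀ x : R.X n, f (n+1) (R.s n i x) = S.s n i (f n x))

/-- The property of being a simplicial ring: all simplicial identities hold and all face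
and degeneracy maps are ring homomorphisms. -/
def IsSimplicialRing (D : SRingData.{u}) : Prop :=
  (∀ n i (x y : D.X (n+1)), D.d n i (x + y) = D.d n i x + D.d n i y) ∧
  (∀ n i (x y : D.X (n+1)), D.d n i (x * y) = D.d n i x * D.d n i y) ∧
  (∀ n i, D.d n i (1 : D.X (n+1)) = 1) ∧
  (∀ n i (x y : D.X n), D.s n i (x + y) = D.s n i x + D.s n i y) ∧
  (∀ n i (x y : D.X n), D.s n i (x * y) = D.s n i x * D.s n i y) ∧
  (∀ n i, D.s n i (1 : D.X n) = 1) ∧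
  (∀ n i j, i < j → j ≤ n + 2 → ∀ x : D.X (n+2),
    D.d n i (D.d (n+1) j x) = D.d n (j-1) (D.d (n+1) i x)) ∧
  (∀ n i j, i ≤ j → j ≤ n → ∀ x : D.X n,
    D.s (n+1) i (D.s n j x) = D.s (n+1) (j+1) (D.s n i x)) ∧
  (∀ n i j, i < j → j ≤ n + 1 → ∀ x : D.X (n+1),
    D.d (n+1) i (D.s (n+1) j x) = D.s n (j-1) (D.d n i x)) ∧
  (∀ n j, j ≤ n → ∀ x : D.X n, D.d n j (D.s n j x) = x) ∧
  (∀ n j, j ≤ n → ∀ x : D.X n, D.d n (j+1) (D.s n j x) = x) ∧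
  (∀ n i j, j + 1 < i → i ≤ n + 2 → ∀ x : D.X (n+1),
    D.d (n+1) i (D.s (n+1) j x) = D.s n j (D.d n (i-1) x))

section Faces

theorem Wd_zero (R : SRingData.{u}) : ∀ n (x : WObj R (n + 1)), Wd R n 0 x = x.2
  | 0, _ => rfl
  | _ + 1, _ => rfl

theorem Wd_add (R : SRing.{u}) : ∀ n i (x y : WObj R.toSRingData (n + 1)),
    Wd _ n i (x + y) = Wd _ n i x + Wd _ n i y
  | 0, 0, _, _ => rfl
  | _ + 1, 0, _, _ => rfl
  | 0, i + 1, x, y => R.d_add 0 (i + 1) x.1 y.1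
  | n + 1, i + 1, x, y => Prod.ext (R.d_add (n + 1) (i + 1) x.1 y.1) (Wd_add R n i x.2 y.2)

theorem Wd_mul (R : SRing.{u}) : ∀ n i (x y : WObj R.toSRingData (n + 1)),
    Wd _ n i (x * y) = Wd _ n i x * Wd _ n i y
  | 0, 0, _, _ => rfl
  | _ + 1, 0, _, _ => rfl
  | 0, i + 1, x, y => R.d_mul 0 (i + 1) x.1 y.1
  | n + 1, i + 1, x, y => Prod.ext (R.d_mul (n + 1) (i + 1) x.1 y.1) (Wd_mul R n i x.2 y.2)

theorem Wd_one (R : SRing.{u}) : ∀ n i, Wd R.toSRingData n i 1 = 1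
  | 0, 0 => rfl
  | _ + 1, 0 => rfl
  | 0, i + 1 => R.d_one 0 (i + 1)
  | n + 1, i + 1 => Prod.ext (R.d_one (n + 1) (i + 1)) (Wd_one R n i)

theorem Wd_Wd (R : SRing.{u}) : ∀ n i j, i < j → j ≤ n + 2 →
    ∀ x : WObj R.toSRingData (n + 2),
      Wd _ n i (Wd _ (n + 1) j x) = Wd _ n (j - 1) (Wd _ (n + 1) i x)
  | 0, 0, _ + 1, _, _, _ => rfl
  | _ + 1, 0, _ + 1, _, _, _ => rfl
  | 0, i + 1, j + 2, h, h', x => R.d_d 0 (i + 1) (j + 2) h h' x.1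
  | n + 1, i + 1, j + 2, h, h', x =>
    Prod.ext (R.d_d (n + 1) (i + 1) (j + 2) h h' x.1)
      (Wd_Wd R n i (j + 1) (by omega) (by omega) x.2)

end Faces

section Degeneracies

theorem Ws_add (R : SRing.{u}) : ∀ n i (x y : WObj R.toSRingData n),
    Ws _ n i (x + y) = Ws _ n i x + Ws _ n i y
  | 0, _, x, y => Prod.ext (R.s_add 0 0 x y) rfl
  | n + 1, 0, x, y => Prod.ext (R.s_add (n + 1) 0 x.1 y.1) rfl
  | n + 1, i + 1, x, y => Prod.ext (R.s_add (n + 1) (i + 1) x.1 y.1) (Ws_add R n i x.2 y.2)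

theorem Ws_mul (R : SRing.{u}) : ∀ n i (x y : WObj R.toSRingData n),
    Ws _ n i (x * y) = Ws _ n i x * Ws _ n i y
  | 0, _, x, y => Prod.ext (R.s_mul 0 0 x y) rfl
  | n + 1, 0, x, y => Prod.ext (R.s_mul (n + 1) 0 x.1 y.1) rfl
  | n + 1, i + 1, x, y => Prod.ext (R.s_mul (n + 1) (i + 1) x.1 y.1) (Ws_mul R n i x.2 y.2)

theorem Ws_one (R : SRing.{u}) : ∀ n i, Ws R.toSRingData n i 1 = 1
  | 0, _ => Prod.ext (R.s_one 0 0) rfl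
  | n + 1, 0 => Prod.ext (R.s_one (n + 1) 0) rfl
  | n + 1, i + 1 => Prod.ext (R.s_one (n + 1) (i + 1)) (Ws_one R n i)

theorem Ws_Ws (R : SRing.{u}) : ∀ n i j, i ≤ j → j ≤ n → ∀ x : WObj R.toSRingData n,
    Ws _ (n + 1) i (Ws _ n j x) = Ws _ (n + 1) (j + 1) (Ws _ n i x)
  | 0, i, j + 1, _, h, _ => by omega
  | 0, 0, 0, h, h', x => Prod.ext (R.s_s 0 0 0 h h' x) rfl
  | n + 1, 0, 0, h, h', x => Prod.ext (R.s_s (n + 1) 0 0 h h' x.1) rfl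
  | n + 1, 0, j + 1, h, h', x => Prod.ext (R.s_s (n + 1) 0 (j + 1) h h' x.1) rfl
  | n + 1, i + 1, j + 1, h, h', x =>
    Prod.ext (R.s_s (n + 1) (i + 1) (j + 1) h h' x.1)
      (Ws_Ws R n i j (by omega) (by omega) x.2)

theorem Wd_Ws_lt (R : SRing.{u}) : ∀ n i j, i < j → j ≤ n + 1 →
    ∀ x : WObj R.toSRingData (n + 1),
      Wd _ (n + 1) i (Ws _ (n + 1) j x) = Ws _ n (j - 1) (Wd _ n i x)
  | 0, 0, 1, _, _, _ => rfl
  | 0, 0, j + 2, _, h, _ => by omega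
  | 0, i + 1, j, h, h', _ => by omega
  | _ + 1, 0, _ + 1, _, _, _ => rfl
  | n + 1, i + 1, j + 2, h, h', x =>
    Prod.ext (R.d_s_lt (n + 1) (i + 1) (j + 2) h h' x.1)
      (Wd_Ws_lt R n i (j + 1) (by omega) (by omega) x.2)

theorem Wd_Ws_self (R : SRing.{u}) : ∀ n j, j ≤ n → ∀ x : WObj R.toSRingData n,
    Wd _ n j (Ws _ n j x) = x
  | 0, 0, _, _ => rfl
  | _ + 1, 0, _, _ => rfl
  | n + 1, j + 1, h, x =>
    Prod.ext (R.d_s_self (n + 1) (j + 1) h x.1) (Wd_Ws_self R n j (by omega) x.2)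

theorem Wd_Ws_succ (R : SRing.{u}) : ∀ n j, j ≤ n → ∀ x : WObj R.toSRingData n,
    Wd _ n (j + 1) (Ws _ n j x) = x
  | 0, 0, h, x => R.d_s_succ 0 0 h x
  | n + 1, 0, h, x => Prod.ext (R.d_s_succ (n + 1) 0 h x.1) (Wd_zero _ n x)
  | n + 1, j + 1, h, x =>
    Prod.ext (R.d_s_succ (n + 1) (j + 1) h x.1) (Wd_Ws_succ R n j (by omega) x.2)

theorem Wd_Ws_gt (R : SRing.{u}) : ∀ n i j, j + 1 < i → i ≤ n + 2 →
    ∀ x : WObj R.toSRingData (n + 1),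
      Wd _ (n + 1) i (Ws _ (n + 1) j x) = Ws _ n j (Wd _ n (i - 1) x)
  | 0, i, j + 1, h, h', _ => by omega
  | 0, i + 2, 0, h, h', x => Prod.ext (R.d_s_gt 0 (i + 2) 0 h h' x.1) rfl
  | n + 1, i + 2, 0, h, h', x => Prod.ext (R.d_s_gt (n + 1) (i + 2) 0 h h' x.1) rfl
  | n + 1, i + 2, j + 1, h, h', x =>
    Prod.ext (R.d_s_gt (n + 1) (i + 2) (j + 1) h h' x.1)
      (Wd_Ws_gt R n (i + 1) j (by omega) (by omega) x.2)

end Degeneracies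

/-- The simplicial ring `W_gr R`. -/
def Wgr (R : SRing.{u}) : SRing.{u} where
  toSRingData := WgrData R.toSRingData
  d_add := Wd_add R
  d_mul := Wd_mul R
  d_one := Wd_one R
  s_add := Ws_add R
  s_mul := Ws_mul R
  s_one := Ws_one R
  d_d := Wd_Wd R
  s_s := Ws_Ws R
  d_s_lt := Wd_Ws_lt R
  d_s_self := Wd_Ws_self R
  d_s_succ := Wd_Ws_succ R
  d_s_gt := Wd_Ws_gt R

theorem SRing.isSimplicialRing (R : SRing.{u}) : IsSimplicialRing R.toSRingData :=
  ⟨R.d_add, R.d_mul, R.d_one, R.s_add, R.s_mul, R.s_one, R.d_d, R.s_s, R.d_s_lt, R.d_s_self,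
    R.d_s_succ, R.d_s_gt⟩

section Wmap

variable {R S T : SRingData.{u}}

theorem Wmap_id : ∀ n (x : WObj R n), Wmap R R (fun _ r => r) n x = x
  | 0, _ => rfl
  | n + 1, x => Prod.ext rfl (Wmap_id n x.2)

theorem Wmap_comp (f : ∀ n, R.X n → S.X n) (g : ∀ n, S.X n → T.X n) :
    ∀ n (x : WObj R n),
      Wmap R T (fun m y => g m (f m y)) n x = Wmap S T g n (Wmap R S f n x)
  | 0, _ => rfl
  | n + 1, x => Prod.ext rfl (Wmap_comp f g n x.2)

theorem Wfst_Wmap (f : ∀ n, R.X n → S.X n) :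
    ∀ n (x : WObj R n), Wfst S n (Wmap R S f n x) = f n (Wfst R n x)
  | 0, _ => rfl
  | _ + 1, _ => rfl

/-- `Wmap f` is a morphism as soon as `f` is a levelwise ring homomorphism commuting with the
degeneracies and with all faces except possibly `d_0`. -/
theorem isSRingMor_Wmap {f : ∀ n, R.X n → S.X n}
    (hadd : ∀ n (x y : R.X n), f n (x + y) = f n x + f n y)
    (hmul : ∀ n (x y : R.X n), f n (x * y) = f n x * f n y)
    (hone : ∀ n, f n (1 : R.X n) = 1)
    (hd : ∀ n i, i ≤ n → ∀ x : R.X (n + 1), f n (R.d n (i + 1) x) = S.d n (i + 1) (f (n + 1) x))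
    (hs : ∀ n i, i ≤ n → ∀ x : R.X n, f (n + 1) (R.s n i x) = S.s n i (f n x)) :
    IsSRingMor (WgrData R) (WgrData S) (Wmap R S f) := by
  refine ⟨fun n => ?_, fun n => ?_, fun n => ?_, fun n => ?_, fun n => ?_⟩
  · induction n with
    | zero => exact hadd 0
    | succ n ih => exact fun x y => Prod.ext (hadd (n + 1) x.1 y.1) (ih x.2 y.2)
  · induction n with
    | zero => exact hmul 0
    | succ n ih => exact fun x y => Prod.ext (hmul (n + 1) x.1 y.1) (ih x.2 y.2)
  · induction n with
    | zero => exact hone 0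
    | succ n ih => exact Prod.ext (hone (n + 1)) ih
  · induction n with
    | zero =>
      rintro (_ | i) h x
      · rfl
      · exact hd 0 i (by omega) x.1
    | succ n ih =>
      rintro (_ | i) h x
      · rfl
      · exact Prod.ext (hd (n + 1) i (by omega) x.1) (ih i (by omega) x.2)
  · induction n with
    | zero =>
      rintro i h x
      obtain rfl : i = 0 := by omega
      exact Prod.ext (hs 0 0 le_rfl x) rfl
    | succ n ih =>
      rintro (_ | i) h x
      · exact Prod.ext (hs (n + 1) 0 (by omega) x.1) rfl
      · exact Prod.ext (hs (n + 1) (i + 1) h x.1) (ih i (by omega) x.2)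

theorem IsSRingMor.Wmap {f : ∀ n, R.X n → S.X n} (hf : IsSRingMor R S f) :
    IsSRingMor (WgrData R) (WgrData S) (Wmap R S f) :=
  isSRingMor_Wmap hf.1 hf.2.1 hf.2.2.1 (fun n i h => hf.2.2.2.1 n (i + 1) (by omega))
    hf.2.2.2.2

theorem Wmap_Wiota {f : ∀ n, R.X n → S.X n} (hf : IsSRingMor R S f) :
    ∀ n (r : R.X n), Wmap R S f n (Wiota R n r) = Wiota S n (f n r)
  | 0, _ => rfl
  | n + 1, r => Prod.ext rfl <| (Wmap_Wiota hf n (R.d n 0 r)).trans <|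
      congrArg (Wiota S n) (hf.2.2.2.1 n 0 (Nat.zero_le _) r)

end Wmap

theorem isSRingMor_Wiota (R : SRing.{u}) :
    IsSRingMor R.toSRingData (WgrData R.toSRingData) (Wiota R.toSRingData) := by
  refine ⟨fun n => ?_, fun n => ?_, fun n => ?_, fun n => ?_, fun n => ?_⟩
  · induction n with
    | zero => exact fun _ _ => rfl
    | succ n ih =>
      exact fun x y => Prod.ext rfl ((congrArg (Wiota _ n) (R.d_add n 0 x y)).trans (ih _ _))
  · induction n with
    | zero => exact fun _ _ => rfl
    | succ n ih =>
      exact fun x y => Prod.ext rfl ((congrArg (Wiota _ n) (R.d_mul n 0 x y)).trans (ih _ _))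
  · induction n with
    | zero => rfl
    | succ n ih => exact Prod.ext rfl ((congrArg (Wiota _ n) (R.d_one n 0)).trans ih)
  · induction n with
    | zero =>
      rintro (_ | i) h x
      · rfl
      · rfl
    | succ n ih =>
      rintro (_ | i) h x
      · rfl
      · exact Prod.ext rfl <|
          (congrArg (Wiota _ n) (R.d_d n 0 (i + 1) (by omega) (by omega) x)).trans
            (ih i (by omega) _)
  · induction n with
    | zero =>
      rintro i h x
      obtain rfl : i = 0 := by omega
      exact Prod.ext rfl (R.d_s_self 0 0 le_rfl x)
    | succ n ih =>
      rintro (_ | i) h x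
      · exact Prod.ext rfl (congrArg (Wiota _ (n + 1)) (R.d_s_self (n + 1) 0 (by omega) x))
      · exact Prod.ext rfl <|
          (congrArg (Wiota _ (n + 1)) (R.d_s_lt n 0 (i + 1) (by omega) (by omega) x)).trans
            (ih i (by omega) _)

section Wmu

variable (R : SRingData.{u})

theorem isSRingMor_Wmu : IsSRingMor (WgrData (WgrData R)) (WgrData R) (Wmu R) := by
  refine isSRingMor_Wmap ?_ ?_ ?_ ?_ ?_
  · rintro (_ | n) x y <;> rfl
  · rintro (_ | n) x y <;> rfl
  · rintro (_ | n) <;> rfl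
  · rintro (_ | n) i h x <;> rfl
  · rintro (_ | n) (_ | i) h x
    · rfl
    · omega
    · rfl
    · rfl

theorem Wfst_Wiota : ∀ n (r : R.X n), Wfst R n (Wiota R n r) = r
  | 0, _ => rfl
  | _ + 1, _ => rfl

theorem Wmu_Wiota : ∀ n (x : WObj R n), Wmu R n (Wiota (WgrData R) n x) = x
  | 0, _ => rfl
  | n + 1, x => Prod.ext rfl <|
      (congrArg (fun y => Wmu R n (Wiota (WgrData R) n y)) (Wd_zero R n x)).trans
        (Wmu_Wiota n x.2)

theorem Wmu_Wmap_Wiota (n : ℕ) (x : WObj R n) :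
    Wmu R n (Wmap R (WgrData R) (Wiota R) n x) = x := by
  refine (Wmap_comp (S := WgrData R) (Wiota R) (Wfst R) n x).symm.trans ?_
  simp only [Wfst_Wiota, Wmap_id]

theorem Wmap_Wmu {R S : SRingData.{u}} (f : ∀ n, R.X n → S.X n) (n : ℕ)
    (x : WObj (WgrData R) n) :
    Wmap R S f n (Wmu R n x) = Wmu S n (Wmap (WgrData R) (WgrData S) (Wmap R S f) n x) := by
  refine (Wmap_comp (R := WgrData R) (Wfst R) f n x).symm.trans
    (Eq.trans ?_ (Wmap_comp (R := WgrData R) (S := WgrData S) (Wmap R S f) (Wfst S) n x))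
  exact congrArg (fun g => Wmap (WgrData R) S g n x)
    (funext fun m => funext fun y => (Wfst_Wmap f m y).symm)

theorem Wmu_Wmap_Wmu (n : ℕ) (x : WObj (WgrData (WgrData R)) n) :
    Wmu R n (Wmap (WgrData (WgrData R)) (WgrData R) (Wmu R) n x) =
      Wmu R n (Wmu (WgrData R) n x) :=
  (Wmap_Wmu (fun n => Wfst R n) n x).symm

end Wmu

/-- For every simplicial ring `R`, the data `W_gr R` (componentwise ring
structure, faces/degeneracies as above) is a simplicial ring, and the unit
`ι_R : r ↦ (r, d_0 r, …, d_0ⁿ r)` and multiplication `μ_R` (levelwise the product of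
first-factor projections) are morphisms of simplicial rings making `W_gr` a monad on the
category of simplicial rings. -/
theorem Wgr_ring_monad :
    -- `W_gr R` is a simplicial ring
    (∀ R : SRing.{u}, IsSimplicialRing (WgrData R.toSRingData) ∧
      ∃ H : SRing.{u}, H.toSRingData = WgrData R.toSRingData) ∧
    -- functoriality
    (∀ (R S : SRing.{u}) (f : ∀ n, R.X n → S.X n),
      IsSRingMor R.toSRingData S.toSRingData f →
        IsSRingMor (WgrData R.toSRingData) (WgrData S.toSRingData)
          (Wmap R.toSRingData S.toSRingData f)) ∧
    (∀ (R : SRing.{u}) (n : ℕ) (x : WObj R.toSRingData n),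
      Wmap R.toSRingData R.toSRingData (fun _ r => r) n x = x) ∧
    (∀ (R S T : SRing.{u}) (f : ∀ n, R.X n → S.X n) (g : ∀ n, S.X n → T.X n),
      IsSRingMor R.toSRingData S.toSRingData f → IsSRingMor S.toSRingData T.toSRingData g →
        ∀ n x, Wmap R.toSRingData T.toSRingData (fun m y => g m (f m y)) n x =
          Wmap S.toSRingData T.toSRingData g n (Wmap R.toSRingData S.toSRingData f n x)) ∧
    -- `ι` and `μ` are morphisms of simplicial rings
    (∀ R : SRing.{u},
      IsSRingMor R.toSRingData (WgrData R.toSRingData) (Wiota R.toSRingData)) ∧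
    (∀ R : SRing.{u},
      IsSRingMor (WgrData (WgrData R.toSRingData)) (WgrData R.toSRingData)
        (Wmu R.toSRingData)) ∧
    -- naturality of `ι` and `μ`
    (∀ (R S : SRing.{u}) (f : ∀ n, R.X n → S.X n),
      IsSRingMor R.toSRingData S.toSRingData f →
        (∀ n (r : R.X n),
          Wmap R.toSRingData S.toSRingData f n (Wiota R.toSRingData n r) =
            Wiota S.toSRingData n (f n r)) ∧
        (∀ n (x : WObj (WgrData R.toSRingData) n),
          Wmap R.toSRingData S.toSRingData f n (Wmu R.toSRingData n x) =
            Wmu S.toSRingData n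
              (Wmap (WgrData R.toSRingData) (WgrData S.toSRingData)
                (Wmap R.toSRingData S.toSRingData f) n x))) ∧
    -- unit laws
    (∀ (R : SRing.{u}) (n : ℕ) (x : WObj R.toSRingData n),
      Wmu R.toSRingData n
        (Wmap R.toSRingData (WgrData R.toSRingData) (Wiota R.toSRingData) n x) = x) ∧
    (∀ (R : SRing.{u}) (n : ℕ) (x : WObj R.toSRingData n),
      Wmu R.toSRingData n (Wiota (WgrData R.toSRingData) n x) = x) ∧
    -- associativity
    (∀ (R : SRing.{u}) (n : ℕ) (x : WObj (WgrData (WgrData R.toSRingData)) n),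
      Wmu R.toSRingData n
        (Wmap (WgrData (WgrData R.toSRingData)) (WgrData R.toSRingData)
          (Wmu R.toSRingData) n x) =
      Wmu R.toSRingData n (Wmu (WgrData R.toSRingData) n x)) := by
  exact ⟨fun R => ⟨(Wgr R).isSimplicialRing, Wgr R, rfl⟩,
    fun _ _ _ hf => hf.Wmap,
    fun _ => Wmap_id,
    fun _ _ _ f g _ _ => Wmap_comp f g,
    isSRingMor_Wiota,
    fun R => isSRingMor_Wmu R.toSRingData,
    fun _ _ f hf => ⟨Wmap_Wiota hf, Wmap_Wmu f⟩,
    fun R => Wmu_Wmap_Wiota R.toSRingData,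
    fun R => Wmu_Wiota R.toSRingData,
    fun R => Wmu_Wmap_Wmu R.toSRingData⟩
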